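/- arXiv:2010.11318 — 4 statements merged into one kernel-verified Lean document; each statement's English description precedes it below -/
import Mathlib

section
/- Let G be a group, Γ a subgroup of G, γ₀ ∈ Γ, and let P₁, P₂, Q be subgroups of G such that both P₁ and P₂ are Γ-conjugate to Q (i.e., for each i there exists δ ∈ Γ with δP_iδ⁻¹ = Q). Then the following three conditions are equivalent: (i) Δ₀(P₁)_Q = Δ₀(P₂)_Q; (ii) Δ₀(P₁)_Q ∩ Δ₀(P₂)_Q ≠ ∅; (iii) P₁ and P₂ are Γ_{γ₀}-conjugate, i.e., there exists c ∈ Γ_{γ₀} with cP₁c⁻¹ = P₂. -/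
/-- The conjugate subgroup `g P g⁻¹`. -/
def conjSubgroup {G : Type*} [Group G] (g : G) (P : Subgroup G) : Subgroup G :=
  Subgroup.map (MulAut.conj g).toMonoidHom P

/-- `Δ₀(P)_Q = {δ γ₀ δ⁻¹ : δ ∈ Γ, δ P δ⁻¹ = Q}`. -/
def Delta0 {G : Type*} [Group G] (Γ : Subgroup G) (γ₀ : G) (P Q : Subgroup G) : Set G :=
  {x | ∃ δ ∈ Γ, conjSubgroup δ P = Q ∧ x = δ * γ₀ * δ⁻¹}

theorem conjSubgroup_mul {G : Type*} [Group G] (g h : G) (P : Subgroup G) :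
    conjSubgroup (g * h) P = conjSubgroup g (conjSubgroup h P) := by
  simp only [conjSubgroup, Subgroup.map_map]
  congr 1
  ext x
  simp [mul_assoc]

theorem conjSubgroup_one {G : Type*} [Group G] (P : Subgroup G) : conjSubgroup 1 P = P := by
  ext x
  simp [conjSubgroup, Subgroup.mem_map]

theorem conjSubgroup_inv_eq {G : Type*} [Group G] {g : G} {P Q : Subgroup G}
    (h : conjSubgroup g P = Q) : conjSubgroup g⁻¹ Q = P := by
  rw [← h, ← conjSubgroup_mul, inv_mul_cancel, conjSubgroup_one]

theorem Delta0_nonempty {G : Type*} [Group G] {Γ : Subgroup G} (γ₀ : G) {P Q : Subgroup G}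
    (h : ∃ δ ∈ Γ, conjSubgroup δ P = Q) : (Delta0 Γ γ₀ P Q).Nonempty :=
  let ⟨δ, hδ, hP⟩ := h
  ⟨δ * γ₀ * δ⁻¹, δ, hδ, hP, rfl⟩

theorem Delta0_conjSubgroup_subset {G : Type*} [Group G] {Γ : Subgroup G} {γ₀ c : G}
    (hc : c ∈ Γ) (hcomm : Commute c γ₀) (P Q : Subgroup G) :
    Delta0 Γ γ₀ (conjSubgroup c P) Q ⊆ Delta0 Γ γ₀ P Q := by
  rintro x ⟨δ, hδ, hP, rfl⟩
  refine ⟨δ * c, Γ.mul_mem hδ hc, by rw [conjSubgroup_mul, hP], ?_⟩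
  calc δ * γ₀ * δ⁻¹ = δ * (γ₀ * c) * (δ * c)⁻¹ := by group
    _ = δ * c * γ₀ * (δ * c)⁻¹ := by rw [← hcomm.eq, mul_assoc δ c]

theorem Delta0_conjSubgroup {G : Type*} [Group G] {Γ : Subgroup G} {γ₀ c : G}
    (hc : c ∈ Γ) (hcomm : Commute c γ₀) (P Q : Subgroup G) :
    Delta0 Γ γ₀ (conjSubgroup c P) Q = Delta0 Γ γ₀ P Q := by
  refine (Delta0_conjSubgroup_subset hc hcomm P Q).antisymm ?_
  have h := Delta0_conjSubgroup_subset (Γ.inv_mem hc) hcomm.inv_left (conjSubgroup c P) Q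
  rwa [conjSubgroup_inv_eq rfl] at h

theorem exists_conjSubgroup_eq_of_Delta0_inter_nonempty {G : Type*} [Group G] {Γ : Subgroup G}
    {γ₀ : G} {P₁ P₂ Q : Subgroup G}
    (h : (Delta0 Γ γ₀ P₁ Q ∩ Delta0 Γ γ₀ P₂ Q).Nonempty) :
    ∃ c, (c ∈ Γ ∧ c * γ₀ = γ₀ * c) ∧ conjSubgroup c P₁ = P₂ := by
  obtain ⟨x, ⟨δ₁, hδ₁, hP₁, rfl⟩, δ₂, hδ₂, hP₂, hx⟩ := h
  refine ⟨δ₂⁻¹ * δ₁, ⟨Γ.mul_mem (Γ.inv_mem hδ₂) hδ₁, ?_⟩, ?_⟩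
  · calc δ₂⁻¹ * δ₁ * γ₀ = δ₂⁻¹ * (δ₁ * γ₀ * δ₁⁻¹) * δ₁ := by group
      _ = γ₀ * (δ₂⁻¹ * δ₁) := by rw [hx]; group
  · rw [conjSubgroup_mul, hP₁, conjSubgroup_inv_eq hP₂]

theorem stmt3 {G : Type*} [Group G] (Γ : Subgroup G) (γ₀ : G) (hγ₀ : γ₀ ∈ Γ)
    (P₁ P₂ Q : Subgroup G)
    (h1 : ∃ δ ∈ Γ, conjSubgroup δ P₁ = Q)
    (h2 : ∃ δ ∈ Γ, conjSubgroup δ P₂ = Q) :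
    (Delta0 Γ γ₀ P₁ Q = Delta0 Γ γ₀ P₂ Q ↔
      (Delta0 Γ γ₀ P₁ Q ∩ Delta0 Γ γ₀ P₂ Q).Nonempty) ∧
    ((Delta0 Γ γ₀ P₁ Q ∩ Delta0 Γ γ₀ P₂ Q).Nonempty ↔
      ∃ c, (c ∈ Γ ∧ c * γ₀ = γ₀ * c) ∧ conjSubgroup c P₁ = P₂) := by
  have eq_of_conj : (∃ c, (c ∈ Γ ∧ c * γ₀ = γ₀ * c) ∧ conjSubgroup c P₁ = P₂) →
      Delta0 Γ γ₀ P₁ Q = Delta0 Γ γ₀ P₂ Q := by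
    rintro ⟨c, ⟨hc, hcomm⟩, rfl⟩
    exact (Delta0_conjSubgroup hc hcomm P₁ Q).symm
  have nonempty_of_eq (h : Delta0 Γ γ₀ P₁ Q = Delta0 Γ γ₀ P₂ Q) :
      (Delta0 Γ γ₀ P₁ Q ∩ Delta0 Γ γ₀ P₂ Q).Nonempty := by
    rw [← h, Set.inter_self]
    exact Delta0_nonempty γ₀ h1
  exact ⟨⟨nonempty_of_eq, fun h ↦ eq_of_conj (exists_conjSubgroup_eq_of_Delta0_inter_nonempty h)⟩,
    ⟨exists_conjSubgroup_eq_of_Delta0_inter_nonempty, fun h ↦ nonempty_of_eq (eq_of_conj h)⟩⟩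
end

section
/- Let G be a group, Γ a subgroup of G, γ₀ ∈ Γ, 𝒞 a collection of subgroups of G stable under conjugation by elements of Γ, and Q ∈ 𝒞. Let Δ₀ = {γγ₀γ⁻¹ : γ ∈ Γ}, let E = {P ∈ 𝒞 : γ₀ ∈ P and P is Γ-conjugate to Q}, and let E(γ₀) ⊆ E be a set of representatives for the orbits of E under conjugation by the centralizer Γ_{γ₀}. Then the sets Δ₀(P)_Q for P ∈ E(γ₀) are pairwise disjoint and Δ₀ ∩ Q = ⨆_{P ∈ E(γ₀)} Δ₀(P)_Q. -/
theorem conj_mem_conjSubgroup {G : Type*} [Group G] (g : G) {P : Subgroup G} {x : G}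
    (hx : x ∈ P) : g * x * g⁻¹ ∈ conjSubgroup g P :=
  ⟨x, hx, by simp⟩

theorem stmt5 {G : Type*} [Group G] (Γ : Subgroup G) (γ₀ : G) (hγ₀ : γ₀ ∈ Γ)
    (𝒞 : Set (Subgroup G)) (hstab : ∀ γ ∈ Γ, ∀ P ∈ 𝒞, conjSubgroup γ P ∈ 𝒞)
    (Q : Subgroup G) (hQ : Q ∈ 𝒞)
    (E : Set (Subgroup G))
    (hE : E = {P | P ∈ 𝒞 ∧ γ₀ ∈ P ∧ ∃ δ ∈ Γ, conjSubgroup δ P = Q})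
    (Erep : Set (Subgroup G)) (hsub : Erep ⊆ E)
    -- `Erep` is a set of representatives for the orbits of `E` under conjugation by
    -- the centralizer `Γ_{γ₀}`.
    (hrep : ∀ P ∈ E, ∃! P' , P' ∈ Erep ∧
      ∃ c, (c ∈ Γ ∧ c * γ₀ = γ₀ * c) ∧ conjSubgroup c P = P') :
    (Erep.Pairwise fun P₁ P₂ => Disjoint (Delta0 Γ γ₀ P₁ Q) (Delta0 Γ γ₀ P₂ Q)) ∧
    {x | ∃ γ ∈ Γ, x = γ * γ₀ * γ⁻¹} ∩ (Q : Set G) = ⋃ P ∈ Erep, Delta0 Γ γ₀ P Q := by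
  subst hE
  refine ⟨fun P₁ h₁ P₂ h₂ hne => Set.disjoint_left.2 ?_, ?_⟩
  · rintro x ⟨δ₁, hδ₁, hP₁, rfl⟩ ⟨δ₂, hδ₂, hP₂, h⟩
    refine hne ((hrep P₁ (hsub h₁)).unique
      ⟨h₁, 1, ⟨Γ.one_mem, by simp⟩, conjSubgroup_one P₁⟩
      ⟨h₂, δ₂⁻¹ * δ₁, ⟨Γ.mul_mem (Γ.inv_mem hδ₂) hδ₁, ?_⟩, ?_⟩)
    · calc δ₂⁻¹ * δ₁ * γ₀ = δ₂⁻¹ * (δ₁ * γ₀ * δ₁⁻¹) * δ₁ := by group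
        _ = γ₀ * (δ₂⁻¹ * δ₁) := by rw [h]; group
    · rw [conjSubgroup_mul, hP₁, ← hP₂, ← conjSubgroup_mul, inv_mul_cancel, conjSubgroup_one]
  · ext x
    simp only [Set.mem_iUnion]
    constructor
    · rintro ⟨⟨γ, hγ, rfl⟩, hx⟩
      have hmem : γ₀ ∈ conjSubgroup γ⁻¹ Q := by
        have h := conj_mem_conjSubgroup γ⁻¹ hx
        rwa [show γ⁻¹ * (γ * γ₀ * γ⁻¹) * γ⁻¹⁻¹ = γ₀ by group] at h
      obtain ⟨P, ⟨hP, c, ⟨hc, hcomm⟩, hcP⟩, -⟩ := hrep (conjSubgroup γ⁻¹ Q)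
        ⟨hstab _ (Γ.inv_mem hγ) _ hQ, hmem, γ, hγ, by
          rw [← conjSubgroup_mul, mul_inv_cancel, conjSubgroup_one]⟩
      refine ⟨P, hP, γ * c⁻¹, Γ.mul_mem hγ (Γ.inv_mem hc), ?_, ?_⟩
      · rw [← hcP, ← conjSubgroup_mul, ← conjSubgroup_mul,
          show γ * c⁻¹ * c * γ⁻¹ = 1 by group, conjSubgroup_one]
      · calc γ * γ₀ * γ⁻¹ = γ * c⁻¹ * (c * γ₀) * γ⁻¹ := by group
          _ = γ * c⁻¹ * γ₀ * (γ * c⁻¹)⁻¹ := by rw [hcomm]; group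
    · rintro ⟨P, hP, δ, hδ, hδP, rfl⟩
      refine ⟨⟨δ, hδ, rfl⟩, ?_⟩
      rw [← hδP]
      exact conj_mem_conjSubgroup δ (hsub hP).2.1
end

section
/- Let P be a group, N a normal subgroup of P, and M a subgroup of P such that M ∩ N = {1} and MN = P, and let π : P → M be the projection with kernel N (so π(mn) = m for m ∈ M, n ∈ N). Let Γ be a subgroup of P and let γ ∈ Γ ∩ M be an element whose centralizer in N is trivial (the only n ∈ N with nγ = γn is n = 1). Then the set {ηγη⁻¹ : η ∈ Γ} ∩ γN is a disjoint union of conjugacy classes under the subgroup Γ∩N, and the set of these (Γ∩N)-conjugacy classes is in bijection with the coset space π(Γ)_γ / (Γ_γ ∩ M), where π(Γ)_γ is the centralizer of γ in the subgroup π(Γ) of M and Γ_γ is the centralizer of γ in Γ; in particular the number of such classes equals the index [π(Γ)_γ : Γ_γ ∩ M]. -/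
/-- The set of conjugates of `x` by elements of the subgroup `K`. -/
def Subgroup.conjugatesBy {G : Type*} [Group G] (K : Subgroup G) (x : G) : Set G :=
  {y | ∃ k ∈ K, y = k * x * k⁻¹}

namespace Subgroup

variable {G : Type*} [Group G] (K : Subgroup G)

theorem mem_conjugatesBy_self (x : G) : x ∈ K.conjugatesBy x :=
  ⟨1, K.one_mem, by simp⟩

theorem conjugatesBy_eq_of_mem {x y : G} (h : y ∈ K.conjugatesBy x) :
    K.conjugatesBy y = K.conjugatesBy x := by
  obtain ⟨k, hk, rfl⟩ := h
  ext z
  constructor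
  · rintro ⟨l, hl, rfl⟩
    exact ⟨l * k, K.mul_mem hl hk, by group⟩
  · rintro ⟨l, hl, rfl⟩
    exact ⟨l * k⁻¹, K.mul_mem hl (K.inv_mem hk), by group⟩

theorem conjugatesBy_eq_iff {x y : G} :
    K.conjugatesBy y = K.conjugatesBy x ↔ y ∈ K.conjugatesBy x :=
  ⟨fun h => h ▸ K.mem_conjugatesBy_self y, K.conjugatesBy_eq_of_mem⟩

theorem disjoint_conjugatesBy {x y : G} (h : K.conjugatesBy x ≠ K.conjugatesBy y) :
    Disjoint (K.conjugatesBy x) (K.conjugatesBy y) := by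
  rw [Set.disjoint_left]
  intro z hx hy
  exact h ((K.conjugatesBy_eq_of_mem hx).symm.trans (K.conjugatesBy_eq_of_mem hy))

end Subgroup

/-- Two surjections with the same fibres have equivalent codomains. -/
theorem nonempty_equiv_of_surjective_of_eq_iff {α β δ : Type*} {f : α → β} {g : α → δ}
    (hf : Function.Surjective f) (hg : Function.Surjective g)
    (h : ∀ a b, f a = f b ↔ g a = g b) : Nonempty (β ≃ δ) :=
  ⟨(Setoid.quotientKerEquivOfSurjective f hf).symm.trans
    ((Quotient.congrRight h).trans (Setoid.quotientKerEquivOfSurjective g hg))⟩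


theorem stmt8 {P : Type*} [Group P] (N : Subgroup P) [N.Normal] (M : Subgroup P)
    (hMN : M ⊓ N = ⊥) (hgen : ∀ p : P, ∃ m ∈ M, ∃ n ∈ N, p = m * n)
    (π : P →* P) (hπ : ∀ m ∈ M, ∀ n ∈ N, π (m * n) = m)
    (Γ : Subgroup P) (γ : P) (hγΓ : γ ∈ Γ) (hγM : γ ∈ M)
    -- the centralizer of `γ` in `N` is trivial
    (hcent : ∀ n ∈ N, n * γ = γ * n → n = 1)
    -- `S = {η γ η⁻¹ : η ∈ Γ} ∩ γN`
    (S : Set P)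
    (hS : S = {x | ∃ η ∈ Γ, x = η * γ * η⁻¹} ∩ {x | ∃ n ∈ N, x = γ * n})
    -- the set of `(Γ ∩ N)`-conjugacy classes meeting `S`
    (classes : Set (Set P))
    (hclasses : classes = {C | ∃ x ∈ S, C = {y | ∃ ν, (ν ∈ Γ ∧ ν ∈ N) ∧ y = ν * x * ν⁻¹}}) :
    -- `S` is invariant under `(Γ ∩ N)`-conjugation, hence is the (automatically
    -- disjoint) union of the `(Γ ∩ N)`-conjugacy classes comprising `classes`
    (∀ x ∈ S, ∀ ν, ν ∈ Γ → ν ∈ N → ν * x * ν⁻¹ ∈ S) ∧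
    S = ⋃₀ classes ∧
    (classes.Pairwise fun C₁ C₂ => Disjoint C₁ C₂) ∧
    -- the set of classes is in bijection with `π(Γ)_γ / (Γ_γ ∩ M)`
    Nonempty (classes ≃
      ((Γ.map π ⊓ Subgroup.centralizer {γ} : Subgroup P) ⧸
        (Γ ⊓ Subgroup.centralizer {γ} ⊓ M).subgroupOf
          (Γ.map π ⊓ Subgroup.centralizer {γ}))) ∧
    Nat.card classes =
      ((Γ ⊓ Subgroup.centralizer {γ} ⊓ M).subgroupOf
        (Γ.map π ⊓ Subgroup.centralizer {γ})).index := by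
  have hπM : ∀ m ∈ M, π m = m := fun m hm => by simpa using hπ m hm 1 N.one_mem
  have hπN : ∀ n ∈ N, π n = 1 := fun n hn => by simpa using hπ 1 M.one_mem n hn
  have hker : ∀ p, π p = 1 → p ∈ N := by
    intro p hp
    obtain ⟨m, hm, n, hn, rfl⟩ := hgen p
    rw [hπ m hm n hn] at hp
    simpa [hp] using hn
  have hπγ : π γ = γ := hπM γ hγM
  have hcentM : ∀ δ, δ * γ = γ * δ → δ ∈ M := by
    intro δ hδ
    obtain ⟨m, hm, n, hn, rfl⟩ := hgen δ
    have hmγ : m * γ = γ * m := by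
      simpa [hπγ, hπ m hm n hn] using congrArg π hδ
    have hnγ : n * γ = γ * n := by
      apply mul_left_cancel (a := m)
      rw [← mul_assoc, hδ, ← mul_assoc, ← mul_assoc, hmγ]
    simpa [hcent n hn hnγ] using hm
  have hmemS : ∀ x, x ∈ S ↔ ∃ η ∈ Γ, π η * γ = γ * π η ∧ x = η * γ * η⁻¹ := by
    intro x
    rw [hS]
    constructor
    · rintro ⟨⟨η, hη, rfl⟩, n, hn, h⟩
      refine ⟨η, hη, ?_, rfl⟩
      have := congrArg π h
      simpa [hπγ, hπN n hn, mul_inv_eq_iff_eq_mul] using this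
    · rintro ⟨η, hη, hc, rfl⟩
      refine ⟨⟨η, hη, rfl⟩, γ⁻¹ * (η * γ * η⁻¹), hker _ ?_, by group⟩
      simp [hπγ, hc]
  have hclasses' : classes = {C | ∃ x ∈ S, C = (Γ ⊓ N).conjugatesBy x} := hclasses
  have hinv : ∀ x ∈ S, ∀ ν, ν ∈ Γ → ν ∈ N → ν * x * ν⁻¹ ∈ S := by
    intro x hx ν hνΓ hνN
    obtain ⟨η, hη, hc, rfl⟩ := (hmemS x).1 hx
    exact (hmemS _).2 ⟨ν * η, Γ.mul_mem hνΓ hη, by simpa [hπN ν hνN] using hc, by group⟩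
  have hequiv : Nonempty (classes ≃
      ((Γ.map π ⊓ Subgroup.centralizer {γ} : Subgroup P) ⧸
        (Γ ⊓ Subgroup.centralizer {γ} ⊓ M).subgroupOf
          (Γ.map π ⊓ Subgroup.centralizer {γ}))) := by
    let A := {η : P // η ∈ Γ ∧ π η * γ = γ * π η}
    let f : A → classes := fun a =>
      ⟨(Γ ⊓ N).conjugatesBy (a.1 * γ * a.1⁻¹), by
        rw [hclasses']
        exact ⟨_, (hmemS _).2 ⟨a.1, a.2.1, a.2.2, rfl⟩, rfl⟩⟩
    let g : A → (Γ.map π ⊓ Subgroup.centralizer {γ} : Subgroup P) := fun a =>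
      ⟨π a.1, Subgroup.mem_map_of_mem π a.2.1, Subgroup.mem_centralizer_singleton_iff.2 a.2.2⟩
    have hf : Function.Surjective f := by
      rintro ⟨C, hC⟩
      obtain ⟨x, hx, rfl⟩ := hclasses' ▸ hC
      obtain ⟨η, hη, hc, rfl⟩ := (hmemS x).1 hx
      exact ⟨⟨η, hη, hc⟩, rfl⟩
    have hg : Function.Surjective g := by
      rintro ⟨_, ⟨η, hη, rfl⟩, hc⟩
      exact ⟨⟨η, hη, Subgroup.mem_centralizer_singleton_iff.1 hc⟩, rfl⟩
    refine nonempty_equiv_of_surjective_of_eq_iff hf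
      ((QuotientGroup.mk_surjective).comp hg) ?_
    rintro ⟨a, haΓ, ha⟩ ⟨b, hbΓ, hb⟩
    simp only [f, g, Function.comp_apply, Subtype.mk.injEq, QuotientGroup.eq,
      Subgroup.mem_subgroupOf, Subgroup.conjugatesBy_eq_iff]
    change _ ↔ (π a)⁻¹ * π b ∈ Γ ⊓ Subgroup.centralizer {γ} ⊓ M
    constructor
    · rintro ⟨ν, ⟨hνΓ, hνN⟩, h⟩
      have hδ : a⁻¹ * ν * b * γ = γ * (a⁻¹ * ν * b) := by
        calc a⁻¹ * ν * b * γ = a⁻¹ * (ν * (b * γ * b⁻¹) * ν⁻¹) * ν * b := by group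
          _ = γ * (a⁻¹ * ν * b) := by rw [← h]; group
      have hδM := hcentM _ hδ
      have hπδ : (π a)⁻¹ * π b = a⁻¹ * ν * b := by
        simpa [hπN ν hνN] using hπM _ hδM
      rw [hπδ]
      exact ⟨⟨Γ.mul_mem (Γ.mul_mem (Γ.inv_mem haΓ) hνΓ) hbΓ,
        Subgroup.mem_centralizer_singleton_iff.2 hδ⟩, hδM⟩
    · rintro ⟨⟨hδΓ, hδc⟩, hδM⟩
      have hπδ := hπM _ hδM
      replace hδc := Subgroup.mem_centralizer_singleton_iff.1 hδc
      generalize hδ : (π a)⁻¹ * π b = δ at hδΓ hδc hδM hπδ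
      refine ⟨a * δ * b⁻¹, ⟨Γ.mul_mem (Γ.mul_mem haΓ hδΓ) (Γ.inv_mem hbΓ), hker _ ?_⟩, ?_⟩
      · rw [map_mul, map_mul, hπδ, ← hδ, map_inv]
        group
      · calc a * γ * a⁻¹ = a * (γ * δ) * δ⁻¹ * a⁻¹ := by group
          _ = a * δ * b⁻¹ * (b * γ * b⁻¹) * (a * δ * b⁻¹)⁻¹ := by rw [← hδc]; group
  refine ⟨hinv, ?_, ?_, hequiv, Nat.card_congr hequiv.some⟩
  · rw [hclasses']
    ext x
    constructor
    · exact fun hx => ⟨_, ⟨x, hx, rfl⟩, Subgroup.mem_conjugatesBy_self _ x⟩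
    · rintro ⟨_, ⟨y, hy, rfl⟩, ν, ⟨hνΓ, hνN⟩, rfl⟩
      exact hinv y hy ν hνΓ hνN
  · rw [hclasses']
    rintro _ ⟨x, -, rfl⟩ _ ⟨y, -, rfl⟩ hne
    exact Subgroup.disjoint_conjugatesBy _ hne
end

section
/- Let P be a group, N a normal subgroup of P, and M a subgroup of P such that M ∩ N = {1} and MN = P, and let π : P → M be the projection with kernel N (so π(mn) = m for m ∈ M, n ∈ N). Let Γ be a subgroup of P and γ ∈ Γ ∩ M. Then: (a) for η ∈ Γ, one has ηγη⁻¹ ∈ γN if and only if π(η) centralizes γ; and (b) for η₁, η₂ ∈ Γ, the elements η₁γη₁⁻¹ and η₂γη₂⁻¹ are conjugate by an element of Γ∩N if and only if η₁·Γ_γ·(Γ∩N) = η₂·Γ_γ·(Γ∩N), where Γ_γ is the centralizer of γ in Γ. -/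
open scoped Pointwise

section SemidirectConjugacy

variable {P : Type*} [Group P]

lemma conj_eq_conj_iff_inv_mul_mem_centralizer {x y g : P} :
    x * g * x⁻¹ = y * g * y⁻¹ ↔ x⁻¹ * y ∈ Subgroup.centralizer {g} := by
  rw [Subgroup.mem_centralizer_singleton_iff, mul_inv_eq_iff_eq_mul, ← mul_right_inj x⁻¹,
    ← mul_left_inj (x⁻¹ * y)]
  simp only [mul_assoc, mul_inv_cancel_left, inv_mul_cancel_left, inv_mul_cancel, mul_one]
  exact eq_comm

lemma coe_inf_mul_inf_normal (Γ C N : Subgroup P) [N.Normal] :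
    ((Γ ⊓ C : Subgroup P) : Set P) * ((Γ ⊓ N : Subgroup P) : Set P) =
      ((Γ ⊓ C) ⊔ (Γ ⊓ N) : Subgroup P) :=
  (Subgroup.coe_mul_of_left_le_normalizer_right _ _ <|
    (le_inf (inf_le_left.trans Γ.le_normalizer) Subgroup.le_normalizer_of_normal).trans
      Subgroup.inf_normalizer_le_normalizer_inf).symm

lemma exists_conj_eq_conj_iff_leftCoset_eq (N Γ : Subgroup P) [N.Normal] (g : P) {x y : P}
    (hx : x ∈ Γ) (hy : y ∈ Γ) :
    (∃ ν, (ν ∈ Γ ∧ ν ∈ N) ∧ ν * (x * g * x⁻¹) * ν⁻¹ = y * g * y⁻¹) ↔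
      x • (((Γ ⊓ Subgroup.centralizer {g} : Subgroup P) : Set P) *
          ((Γ ⊓ N : Subgroup P) : Set P)) =
        y • (((Γ ⊓ Subgroup.centralizer {g} : Subgroup P) : Set P) *
          ((Γ ⊓ N : Subgroup P) : Set P)) := by
  have key (ν : P) : ν * (x * g * x⁻¹) * ν⁻¹ = y * g * y⁻¹ ↔
      (ν * x)⁻¹ * y ∈ Subgroup.centralizer {g} := by
    rw [← conj_eq_conj_iff_inv_mul_mem_centralizer]
    simp only [mul_inv_rev, mul_assoc]
  rw [coe_inf_mul_inf_normal, leftCoset_eq_iff, ← SetLike.mem_coe, ← coe_inf_mul_inf_normal,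
    Set.mem_mul]
  simp only [key, SetLike.mem_coe, Subgroup.mem_inf]
  constructor
  · rintro ⟨ν, ⟨hνΓ, hνN⟩, hν⟩
    refine ⟨(ν * x)⁻¹ * y, ⟨mul_mem (inv_mem (mul_mem hνΓ hx)) hy, hν⟩, y⁻¹ * ν * y,
      ⟨mul_mem (mul_mem (inv_mem hy) hνΓ) hy, ?_⟩, by group⟩
    simpa using ‹N.Normal›.conj_mem ν hνN y⁻¹
  · rintro ⟨c, ⟨hcΓ, hc⟩, k, ⟨hkΓ, hkN⟩, h⟩
    obtain rfl : y = x * c * k := by rw [mul_assoc, h, mul_inv_cancel_left]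
    have hxc := mul_mem hx hcΓ
    refine ⟨x * c * k * (x * c)⁻¹, ⟨mul_mem (mul_mem hxc hkΓ) (inv_mem hxc),
      ‹N.Normal›.conj_mem k hkN _⟩, ?_⟩
    convert hc using 1
    group

lemma conj_mem_leftCoset_ker_iff_commute {π : P →* P} {N : Subgroup P} (hker : π.ker = N)
    {g : P} (hg : π g = g) (x : P) :
    (∃ n ∈ N, x * g * x⁻¹ = g * n) ↔ π x * g = g * π x := by
  subst hker
  calc (∃ n ∈ π.ker, x * g * x⁻¹ = g * n) ↔ g⁻¹ * (x * g * x⁻¹) ∈ π.ker :=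
        ⟨fun ⟨n, hn, h⟩ ↦ by rwa [h, inv_mul_cancel_left],
          fun h ↦ ⟨_, h, (mul_inv_cancel_left _ _).symm⟩⟩
    _ ↔ π x * g = g * π x := by
        simp only [MonoidHom.mem_ker, map_mul, map_inv, hg]
        rw [inv_mul_eq_one, eq_comm, mul_inv_eq_iff_eq_mul]

lemma ker_eq_of_forall_map_mul_eq {N M : Subgroup P}
    (hgen : ∀ p : P, ∃ m ∈ M, ∃ n ∈ N, p = m * n) {π : P →* P}
    (hπ : ∀ m ∈ M, ∀ n ∈ N, π (m * n) = m) : π.ker = N := by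
  ext p
  rw [MonoidHom.mem_ker]
  refine ⟨fun hp ↦ ?_, fun hp ↦ by simpa using hπ 1 M.one_mem p hp⟩
  obtain ⟨m, hm, n, hn, rfl⟩ := hgen p
  rw [hπ m hm n hn] at hp
  simpa [hp] using hn

end SemidirectConjugacy

theorem stmt9 {P : Type*} [Group P] (N : Subgroup P) [N.Normal] (M : Subgroup P)
    (hMN : M ⊓ N = ⊥) (hgen : ∀ p : P, ∃ m ∈ M, ∃ n ∈ N, p = m * n)
    (π : P →* P) (hπ : ∀ m ∈ M, ∀ n ∈ N, π (m * n) = m)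
    (Γ : Subgroup P) (γ : P) (hγΓ : γ ∈ Γ) (hγM : γ ∈ M) :
    -- (a) `η γ η⁻¹ ∈ γN ↔ π(η)` centralizes `γ`
    (∀ η ∈ Γ, ((∃ n ∈ N, η * γ * η⁻¹ = γ * n) ↔ π η * γ = γ * π η)) ∧
    -- (b) `η₁ γ η₁⁻¹` and `η₂ γ η₂⁻¹` are `(Γ ∩ N)`-conjugate iff
    -- `η₁ Γ_γ (Γ ∩ N) = η₂ Γ_γ (Γ ∩ N)`
    (∀ η₁ ∈ Γ, ∀ η₂ ∈ Γ,
      ((∃ ν, (ν ∈ Γ ∧ ν ∈ N) ∧ ν * (η₁ * γ * η₁⁻¹) * ν⁻¹ = η₂ * γ * η₂⁻¹) ↔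
        η₁ • (((Γ ⊓ Subgroup.centralizer {γ} : Subgroup P) : Set P) *
            ((Γ ⊓ N : Subgroup P) : Set P)) =
          η₂ • (((Γ ⊓ Subgroup.centralizer {γ} : Subgroup P) : Set P) *
            ((Γ ⊓ N : Subgroup P) : Set P)))) := by
  have hγ : π γ = γ := by simpa using hπ γ hγM 1 N.one_mem
  exact ⟨fun η _ ↦
      conj_mem_leftCoset_ker_iff_commute (ker_eq_of_forall_map_mul_eq hgen hπ) hγ η,
    fun _ h₁ _ h₂ ↦ exists_conj_eq_conj_iff_leftCoset_eq N Γ γ h₁ h₂⟩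
end
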